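/- Let (Y, ⪯, id, □, ⁻¹) be an ore and suppose a, b, c are admissible elements which are pairwise orthogonal. Then Φ_a(b) ⊥ Φ_a(c), Φ_b(a) ⊥ Φ_b(c), Φ_c(a) ⊥ Φ_c(b), and the following equalities hold: Φ_{Φ_c(b)}(Φ_c(a)) = Φ_{Φ_b(c)}(Φ_b(a)); Φ_{Φ_a(b)}(Φ_a(c)) = Φ_{Φ_b(a)}(Φ_b(c)); Φ_{Φ_c(a)}(Φ_c(b)) = Φ_{Φ_a(c)}(Φ_a(b)). -/

import Mathlib

noncomputable section

/-- The data of an ore together with axioms (O1), (O2) and (O3): a partial order `le`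
with binary meets and bottom element `idY` (O1), a cancellative monoid structure `op`
with identity `idY` and involution `inv` (O2), such that `le x y` holds iff `y = op x z`
for some `z` (O3). -/
structure OreData (Y : Type) where
  le : Y → Y → Prop
  idY : Y
  op : Y → Y → Y
  inv : Y → Y
  meet : Y → Y → Y
  le_refl : ∀ x, le x x
  le_antisymm : ∀ x y, le x y → le y x → x = y
  le_trans : ∀ x y z, le x y → le y z → le x z
  meet_le_left : ∀ x y, le (meet x y) x
  meet_le_right : ∀ x y, le (meet x y) y
  le_meet : ∀ x y z, le z x → le z y → le z (meet x y)
  id_le : ∀ x, le idY x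
  op_assoc : ∀ x y z, op (op x y) z = op x (op y z)
  op_id : ∀ x, op x idY = x
  id_op : ∀ x, op idY x = x
  cancel_left : ∀ x y z, op x y = op x z → y = z
  cancel_right : ∀ x y z, op x z = op y z → x = y
  inv_invol : ∀ x, inv (inv x) = x
  inv_op : ∀ x y, inv (op x y) = op (inv y) (inv x)
  le_iff : ∀ x y, le x y ↔ ∃ z, y = op x z

namespace OreData

variable {Y : Type} (O : OreData Y)

/-- An element is admissible if it is not of the form `x □ y □ y⁻¹ □ z` with `y ≠ id`. -/
def Admissible (f : Y) : Prop :=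
  ¬ ∃ x y z : Y, y ≠ O.idY ∧ f = O.op (O.op (O.op x y) (O.inv y)) z

/-- `j` is the least upper bound of `x` and `y`. -/
def IsJoin (x y j : Y) : Prop :=
  O.le x j ∧ O.le y j ∧ ∀ s, O.le x s → O.le y s → O.le j s

/-- `j` is the least upper bound of `x`, `y`, `z`. -/
def IsJoin3 (x y z j : Y) : Prop :=
  O.le x j ∧ O.le y j ∧ O.le z j ∧ ∀ s, O.le x s → O.le y s → O.le z s → O.le j s

/-- `j` is the least upper bound of `x`, `y`, `z` within the admissible elements. -/
def IsJoin3G (x y z j : Y) : Prop :=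
  O.Admissible j ∧ O.le x j ∧ O.le y j ∧ O.le z j ∧
    ∀ s, O.Admissible s → O.le x s → O.le y s → O.le z s → O.le j s

/-- `x` and `y` are orthogonal: their meet is `id` and their join exists. -/
def Orth (x y : Y) : Prop := O.meet x y = O.idY ∧ ∃ j, O.IsJoin x y j

/-- Axiom (O4): the admissible elements form a median semilattice. -/
def O4 : Prop :=
  ∀ a b c : Y, O.Admissible a → O.Admissible b → O.Admissible c →
    ∃ m : Y, O.IsJoin3G (O.meet a b) (O.meet b c) (O.meet a c) m ∧
      ∀ x : Y, O.Admissible x →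
        O.IsJoin3G (O.meet x (O.meet a b)) (O.meet x (O.meet b c))
          (O.meet x (O.meet a c)) (O.meet x m)

/-- Axiom (O5). -/
def O5 : Prop :=
  ∀ x y y' : Y, O.Orth x y → O.Admissible x → O.Admissible y' →
    O.IsJoin x y (O.op x y') → O.Admissible y

/-- Axiom (O6). -/
def O6 : Prop :=
  ∀ x y x' y' : Y, O.Admissible x → O.Admissible y → O.Orth x y →
    O.IsJoin x y (O.op x y') → O.IsJoin x y (O.op y x') →
    O.Admissible x' ∧ O.Admissible y' ∧
    O.Orth (O.inv x) y' ∧ O.Orth (O.inv y) x' ∧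
    O.IsJoin (O.inv x) y' (O.op (O.inv x) y) ∧
    O.op (O.inv x) y = O.op y' (O.inv x') ∧
    O.IsJoin (O.inv y) x' (O.inv (O.op (O.inv x) y))

/-- `(Y, ⪯, id, □, ⁻¹)` is an ore: axioms (O1)–(O3) hold by the `OreData` structure and
axioms (O4)–(O6) hold as well. -/
def IsOre : Prop := O.O4 ∧ O.O5 ∧ O.O6

open Classical in
/-- `y ∹ x`: the unique `z` with `y = x □ z` (if it exists; junk value otherwise). -/
def rdiv (y x : Y) : Y :=
  if h : ∃ z, y = O.op x z then h.choose else O.idY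

open Classical in
/-- `y ∸ z`: the unique `x` with `y = x □ z` (if it exists; junk value otherwise). -/
def ldiv (y z : Y) : Y :=
  if h : ∃ x, y = O.op x z then h.choose else O.idY

/-- The star product `f ⋆ g = (f ∸ (f⁻¹ ∧ g)⁻¹) □ (g ∹ (f⁻¹ ∧ g))`. -/
def star (f g : Y) : Y :=
  O.op (O.ldiv f (O.inv (O.meet (O.inv f) g))) (O.rdiv g (O.meet (O.inv f) g))

end OreData

open Classical in
/-- The join of `x` and `y` (junk value if it does not exist; it is unique when it
exists, by antisymmetry). -/
def OreData.jn {Y : Type} (O : OreData Y) (x y : Y) : Y :=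
  if h : ∃ j, O.IsJoin x y j then h.choose else O.idY

/-- The parallel transport `Φ_y(x)`: the unique element with `y ∨ x = y □ Φ_y(x)`. -/
def OreData.pt {Y : Type} (O : OreData Y) (y x : Y) : Y :=
  O.rdiv (O.jn y x) y

namespace OreData

section

variable {Y : Type} {O : OreData Y}

theorem le_op (x y : Y) : O.le x (O.op x y) := (O.le_iff _ _).2 ⟨y, rfl⟩

theorem le_op_of_le {x y : Y} (h : O.le x y) (z : Y) : O.le x (O.op y z) :=
  O.le_trans _ _ _ h (le_op _ _)

theorem op_le_op_iff {x y z : Y} : O.le (O.op x y) (O.op x z) ↔ O.le y z := by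
  rw [O.le_iff, O.le_iff]
  constructor
  · rintro ⟨w, hw⟩
    rw [O.op_assoc] at hw
    exact ⟨w, O.cancel_left _ _ _ hw⟩
  · rintro ⟨w, rfl⟩
    exact ⟨w, (O.op_assoc _ _ _).symm⟩

theorem eq_id_of_le_id {x : Y} (h : O.le x O.idY) : x = O.idY :=
  O.le_antisymm _ _ h (O.id_le x)

theorem inv_id : O.inv O.idY = O.idY := by
  have h := O.inv_op O.idY (O.inv O.idY)
  rw [O.id_op, O.inv_invol, O.id_op] at h
  exact h.symm

theorem inv_eq_id {x : Y} (h : O.inv x = O.idY) : x = O.idY := by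
  rw [← O.inv_invol x, h, inv_id]

theorem meet_eq_left {x y : Y} (h : O.le x y) : O.meet x y = x :=
  O.le_antisymm _ _ (O.meet_le_left _ _) (O.le_meet _ _ _ (O.le_refl _) h)

theorem meet_comm (x y : Y) : O.meet x y = O.meet y x :=
  O.le_antisymm _ _
    (O.le_meet _ _ _ (O.meet_le_right _ _) (O.meet_le_left _ _))
    (O.le_meet _ _ _ (O.meet_le_right _ _) (O.meet_le_left _ _))

theorem eq_id_of_le_of_le {x y d : Y} (h : O.meet x y = O.idY) (hx : O.le d x)
    (hy : O.le d y) : d = O.idY :=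
  eq_id_of_le_id (h ▸ O.le_meet _ _ _ hx hy)

theorem eq_id_of_le_of_meet {x y : Y} (h : O.meet x y = O.idY) (hxy : O.le x y) :
    x = O.idY :=
  eq_id_of_le_of_le h (O.le_refl _) hxy

/-- Dividing two elements by their meet leaves elements with trivial meet. -/
theorem exists_meet_factors (a b : Y) :
    ∃ d a₁ b₁, a = O.op d a₁ ∧ b = O.op d b₁ ∧ O.meet a₁ b₁ = O.idY := by
  obtain ⟨a₁, h₁⟩ := (O.le_iff _ _).1 (O.meet_le_left a b)
  obtain ⟨b₁, h₂⟩ := (O.le_iff _ _).1 (O.meet_le_right a b)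
  refine ⟨O.meet a b, a₁, b₁, h₁, h₂, ?_⟩
  have h : O.le (O.op (O.meet a b) (O.meet a₁ b₁)) (O.op (O.meet a b) O.idY) := by
    rw [O.op_id]
    refine O.le_meet _ _ _ ?_ ?_
    · exact O.le_trans _ _ _ (op_le_op_iff.2 (O.meet_le_left _ _)) (h₁ ▸ O.le_refl _)
    · exact O.le_trans _ _ _ (op_le_op_iff.2 (O.meet_le_right _ _)) (h₂ ▸ O.le_refl _)
  exact eq_id_of_le_id (op_le_op_iff.1 h)

theorem IsJoin.symm {x y j : Y} (h : O.IsJoin x y j) : O.IsJoin y x j :=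
  ⟨h.2.1, h.1, fun s hy hx => h.2.2 s hx hy⟩

theorem IsJoin.unique {x y i j : Y} (hi : O.IsJoin x y i) (hj : O.IsJoin x y j) : i = j :=
  O.le_antisymm _ _ (hi.2.2 _ hj.1 hj.2.1) (hj.2.2 _ hi.1 hi.2.1)

/-- Two elements with a common upper bound have a join: divide the upper bound by the greatest
common right divisor of the complements. -/
theorem exists_isJoin {a b n : Y} (ha : O.le a n) (hb : O.le b n) :
    ∃ b' a', O.op a b' = O.op b a' ∧ O.IsJoin a b (O.op a b') ∧ O.le (O.op a b') n := by
  obtain ⟨u, rfl⟩ := (O.le_iff _ _).1 ha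
  obtain ⟨v, hv⟩ := (O.le_iff _ _).1 hb
  obtain ⟨d, u₁, v₁, h₁, h₂, h₃⟩ := exists_meet_factors (O := O) (O.inv u) (O.inv v)
  have hu : u = O.op (O.inv u₁) (O.inv d) := by rw [← O.inv_op, ← h₁, O.inv_invol]
  have hv' : v = O.op (O.inv v₁) (O.inv d) := by rw [← O.inv_op, ← h₂, O.inv_invol]
  have heq : O.op a (O.inv u₁) = O.op b (O.inv v₁) := by
    rw [hu, hv', ← O.op_assoc, ← O.op_assoc] at hv
    exact O.cancel_right _ _ _ hv
  refine ⟨O.inv u₁, O.inv v₁, heq, ⟨le_op _ _, heq ▸ le_op _ _, fun s has hbs => ?_⟩, ?_⟩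
  · have hl := O.meet_le_left (O.op a (O.inv u₁)) s
    obtain ⟨w, hw⟩ := (O.le_iff _ _).1 hl
    obtain ⟨p, hp⟩ := (O.le_iff _ _).1 (O.le_meet _ _ _ (le_op a (O.inv u₁)) has)
    obtain ⟨q, hq⟩ := (O.le_iff _ _).1 (O.le_meet _ _ _ (heq ▸ le_op b (O.inv v₁)) hbs)
    have hpw : O.inv u₁ = O.op p w := by
      apply O.cancel_left a
      rw [← O.op_assoc, ← hp, ← hw]
    have hqw : O.inv v₁ = O.op q w := by
      apply O.cancel_left b
      rw [← O.op_assoc, ← hq, ← hw, heq]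
    have hu₁ : O.le (O.inv w) u₁ := by
      rw [← O.inv_invol u₁, hpw, O.inv_op]; exact le_op _ _
    have hv₁ : O.le (O.inv w) v₁ := by
      rw [← O.inv_invol v₁, hqw, O.inv_op]; exact le_op _ _
    have hwid : w = O.idY := inv_eq_id (eq_id_of_le_of_le h₃ hu₁ hv₁)
    rw [hwid, O.op_id] at hw
    rw [hw]
    exact O.meet_le_right _ _
  · exact op_le_op_iff.2 (hu ▸ le_op _ _)

theorem exists_op_eq_of_isJoin {a b j : Y} (h : O.IsJoin a b j) :
    ∃ b' a', j = O.op a b' ∧ O.op a b' = O.op b a' := by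
  obtain ⟨b', h₁⟩ := (O.le_iff _ _).1 h.1
  obtain ⟨a', h₂⟩ := (O.le_iff _ _).1 h.2.1
  exact ⟨b', a', h₁, h₁ ▸ h₂⟩

theorem isJoin_of_op {a x y n : Y} (h : O.IsJoin (O.op a x) (O.op a y) (O.op a n)) :
    O.IsJoin x y n :=
  ⟨op_le_op_iff.1 h.1, op_le_op_iff.1 h.2.1, fun _ hx hy =>
    op_le_op_iff.1 (h.2.2 _ (op_le_op_iff.2 hx) (op_le_op_iff.2 hy))⟩

theorem Admissible.left {x y : Y} (h : O.Admissible (O.op x y)) : O.Admissible x := by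
  rintro ⟨p, q, r, hq, rfl⟩
  exact h ⟨p, q, O.op r y, hq, by simp only [O.op_assoc]⟩

theorem Admissible.right {x y : Y} (h : O.Admissible (O.op x y)) : O.Admissible y := by
  rintro ⟨p, q, r, hq, rfl⟩
  exact h ⟨O.op x p, q, r, hq, by simp only [O.op_assoc]⟩

theorem Admissible.of_le {x y : Y} (h : O.Admissible y) (hxy : O.le x y) : O.Admissible x := by
  obtain ⟨z, rfl⟩ := (O.le_iff _ _).1 hxy
  exact h.left

theorem Admissible.inv {x : Y} (h : O.Admissible x) : O.Admissible (O.inv x) := by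
  rintro ⟨p, q, r, hq, hx⟩
  refine h ⟨O.inv r, q, O.inv p, hq, ?_⟩
  rw [← O.inv_invol x, hx]
  simp only [O.inv_op, O.inv_invol, O.op_assoc]

theorem Admissible.eq_id {y z : Y} (h : O.Admissible (O.op y (O.op (O.inv y) z))) :
    y = O.idY := by
  by_contra hy
  exact h ⟨O.idY, y, z, hy, by rw [O.id_op, O.op_assoc]⟩

/-- An element below a product `p □ q` of admissible elements that has trivial meet with `p`
is admissible, and together with `p` it spans a square inside `p □ q`. -/
theorem IsOre.exists_square (hO : O.IsOre) {p q w : Y} (hp : O.Admissible p)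
    (hq : O.Admissible q) (hw : O.le w (O.op p q)) (hm : O.meet p w = O.idY) :
    ∃ w' p' r, O.op p w' = O.op w p' ∧ O.IsJoin p w (O.op p w') ∧ q = O.op w' r ∧
      O.Admissible w ∧ O.Admissible p' ∧ O.Admissible w' := by
  obtain ⟨w', p', h₁, h₂, h₃⟩ := exists_isJoin (le_op p q) hw
  obtain ⟨r, hr⟩ := (O.le_iff _ _).1 (op_le_op_iff.1 h₃)
  have hw' : O.Admissible w' := (hr ▸ hq).left
  have hwa : O.Admissible w := hO.2.1 p w w' ⟨hm, _, h₂⟩ hp hw' h₂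
  have h6 := hO.2.2 p w p' w' hp hwa ⟨hm, _, h₂⟩ h₂ (h₁ ▸ h₂)
  exact ⟨w', p', r, h₁, h₂, hr, hwa, h6.1, hw'⟩

/-- The join of two orthogonal admissible elements is admissible. -/
theorem IsOre.admissible_of_isJoin (hO : O.IsOre) {a b j : Y} (ha : O.Admissible a)
    (hb : O.Admissible b) (hab : O.Orth a b) (hj : O.IsJoin a b j) : O.Admissible j := by
  rintro ⟨x, y, z, hy, hxyz⟩
  apply hy
  obtain ⟨b', a', rfl, hba⟩ := exists_op_eq_of_isJoin hj
  obtain ⟨-, hb', ⟨hab', -⟩, -⟩ := hO.2.2 a b a' b' ha hb hab hj (hba ▸ hj)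
  rw [O.op_assoc, O.op_assoc] at hxyz
  -- split off the common part of `x` and `a`
  obtain ⟨d, a₁, x₁, rfl, rfl, hm₁⟩ := exists_meet_factors (O := O) a x
  have ha₁ := ha.right
  simp only [O.op_assoc] at hxyz
  replace hxyz := O.cancel_left _ _ _ hxyz
  obtain ⟨p, q, u, hpq, hjoin, rfl, hx₁, hq, hp⟩ :=
    hO.exists_square ha₁ hb' (hxyz ▸ le_op _ _) hm₁
  have hu : O.Admissible u := hb'.right
  have hqu : O.op q u = O.op y (O.op (O.inv y) z) := by
    apply O.cancel_left x₁
    rw [← hxyz, ← O.op_assoc, ← O.op_assoc, hpq]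
  -- `y` lies below `q`
  obtain ⟨q₁, rfl⟩ : ∃ q₁, q = O.op y q₁ := by
    obtain ⟨e, q₁, y₁, rfl, rfl, hm₂⟩ := exists_meet_factors (O := O) q y
    simp only [O.op_assoc, O.inv_op] at hqu
    replace hqu := O.cancel_left _ _ _ hqu
    obtain ⟨t, s, w, hts, hj₂, rfl, hy₁, hs, ht⟩ :=
      hO.exists_square hq.right hu (hqu ▸ le_op _ _) hm₂
    have h6 := hO.2.2 q₁ y₁ s t hq.right hy₁ ⟨hm₂, _, hj₂⟩ hj₂ (hts ▸ hj₂)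
    obtain ⟨-, -, -, -, -, h61, h62⟩ := h6
    have hsw : O.op s w = O.op (O.inv y₁) (O.op (O.inv e) z) := by
      apply O.cancel_left y₁
      rw [← hqu, ← O.op_assoc, ← O.op_assoc, hts]
    have hle := h62.2.2 _ (le_op (O.inv y₁) (O.op (O.inv e) z)) (hsw ▸ le_op _ _)
    obtain ⟨z', hz'⟩ := (O.le_iff _ _).1 hle
    rw [← hsw, h61, O.inv_op, O.inv_invol, O.op_assoc] at hz'
    have hw := O.cancel_left _ _ _ hz'
    rw [hw] at hu
    have ht := hu.eq_id
    rw [ht, O.op_id] at hts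
    have hy₁ : y₁ = O.idY := eq_id_of_le_of_meet (meet_comm q₁ y₁ ▸ hm₂) (hts ▸ le_op _ _)
    exact ⟨q₁, by rw [hy₁, O.op_id]⟩
  rw [O.op_assoc] at hqu
  replace hqu := O.cancel_left _ _ _ hqu
  have hm₃ : O.meet q₁ (O.inv y) = O.idY := by
    obtain ⟨f, q₂, y₂, rfl, hy₂, hm⟩ := exists_meet_factors (O := O) q₁ (O.inv y)
    have hyf : y = O.op (O.inv y₂) (O.inv f) := by rw [← O.inv_op, ← hy₂, O.inv_invol]
    rw [hyf, O.op_assoc, ← O.inv_invol f, O.inv_invol (O.inv f)] at hq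
    have hf := inv_eq_id hq.right.eq_id
    rw [hy₂, hf, O.id_op, O.id_op, hm]
  obtain ⟨t, s, w, hts, hj₃, rfl, hyi, hs, ht⟩ :=
    hO.exists_square hq.right hu (hqu ▸ le_op _ _) hm₃
  obtain ⟨-, -, -, -, -, h61, -⟩ :=
    hO.2.2 q₁ (O.inv y) s t hq.right hyi ⟨hm₃, _, hj₃⟩ hj₃ (hts ▸ hj₃)
  have hqst : O.inv (O.op y q₁) = O.op t (O.inv s) := by rw [O.inv_op, h61]
  -- the corner of the square of `a₁` and `x₁` opposite to `id`
  obtain ⟨-, -, ho₁, -, hj₄, h63, -⟩ :=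
    hO.2.2 a₁ x₁ (O.op y q₁) p ha₁ hx₁ ⟨hm₁, _, hjoin⟩ hjoin (hpq ▸ hjoin)
  obtain ⟨-, -, ho₂, -, hj₅, -, -⟩ :=
    hO.2.2 p (O.inv a₁) x₁ (O.inv (O.op y q₁)) hp ha₁.inv
      ⟨meet_comm (O.inv a₁) p ▸ ho₁.1, _, hj₄.symm⟩ (h63 ▸ hj₄.symm) hj₄.symm
  have htq : O.le t (O.inv (O.op y q₁)) := hqst ▸ le_op _ _
  have hm₄ : O.meet (O.inv p) t = O.idY :=
    eq_id_of_le_of_le ho₂.1 (O.meet_le_left _ _)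
      (O.le_trans _ _ _ (O.meet_le_right _ _) htq)
  have htb : O.le t (O.op (O.inv p) (O.inv a₁)) := O.le_trans _ _ _ htq hj₅.2.1
  obtain ⟨t', p', r, htp, hj₆, har, -, hp', ht'⟩ :=
    hO.exists_square hp.inv ha₁.inv htb hm₄
  obtain ⟨-, -, -, -, h64, -, -⟩ :=
    hO.2.2 (O.inv p) t p' t' hp.inv ht ⟨hm₄, _, hj₆⟩ hj₆ (htp ▸ hj₆)
  rw [O.inv_invol] at h64
  have htid : t' = O.idY := by
    refine eq_id_of_le_of_le hab' ?_ ?_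
    · rw [O.inv_op, har]
      exact le_op_of_le (le_op _ _) _
    · rw [← O.op_assoc]
      exact le_op_of_le h64.2.1 _
  rw [htid, O.op_id] at htp
  have ht : t = O.idY :=
    eq_id_of_le_of_meet (meet_comm (O.inv p) t ▸ hm₄) (htp ▸ le_op _ _)
  rw [ht, O.op_id] at hts
  exact inv_eq_id (eq_id_of_le_of_meet (meet_comm q₁ (O.inv y) ▸ hm₃) (hts ▸ le_op _ _))

/-- Distributivity of meets over an admissible join of elements with trivial meet. -/
theorem IsOre.isJoin3G_meet (hO : O.IsOre) {a c p x : Y} (hp : O.Admissible p)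
    (hac : O.meet a c = O.idY) (hj : O.IsJoin a c p) (hx : O.Admissible x) :
    O.IsJoin3G O.idY (O.meet x c) (O.meet x a) (O.meet x p) := by
  obtain ⟨m, hm, hdist⟩ := hO.1 a c p (hp.of_le hj.1) (hp.of_le hj.2.1) hp
  have h := hdist x hx
  rw [hac, meet_eq_left hj.1, meet_eq_left hj.2.1] at hm h
  have hmp : m = p := O.le_antisymm _ _ (hm.2.2.2.2 p hp (O.id_le _) hj.2.1 hj.1)
    (hj.2.2 m hm.2.2.2.1 hm.2.2.1)
  rwa [hmp, meet_comm x O.idY, meet_eq_left (O.id_le x)] at h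

theorem IsOre.meet_join_eq (hO : O.IsOre) {a b c p r : Y} (hp : O.Admissible p)
    (hr : O.Admissible r) (hab : O.meet a b = O.idY) (hac : O.meet a c = O.idY)
    (hbc : O.meet b c = O.idY) (hpj : O.IsJoin a b p) (hrj : O.IsJoin a c r) :
    O.meet p r = a := by
  have hcp : O.meet c p = O.idY := by
    have h := hO.isJoin3G_meet hp hab hpj (hr.of_le hrj.2.1)
    rw [meet_comm c b, hbc, meet_comm c a, hac] at h
    exact eq_id_of_le_id (h.2.2.2.2 _ (hr.of_le (O.id_le _)) (O.le_refl _) (O.le_refl _)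
      (O.le_refl _))
  have h := hO.isJoin3G_meet hr hac hrj hp
  rw [meet_comm p c, hcp, meet_comm p a, meet_eq_left hpj.1] at h
  exact O.le_antisymm _ _
    (h.2.2.2.2 a (hp.of_le hpj.1) (O.id_le _) (O.id_le _) (O.le_refl _)) h.2.2.2.1

/-- Pairwise admissible joins of pairwise orthogonal elements have a triple join. -/
theorem IsOre.exists_isJoin3 (hO : O.IsOre) {a b c p q r : Y} (hp : O.Admissible p)
    (hq : O.Admissible q) (hr : O.Admissible r) (hab : O.meet a b = O.idY)
    (hac : O.meet a c = O.idY) (hbc : O.meet b c = O.idY) (hpj : O.IsJoin a b p)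
    (hqj : O.IsJoin b c q) (hrj : O.IsJoin a c r) : ∃ m, O.IsJoin3 a b c m := by
  obtain ⟨m, ⟨hm, hb, hc, ha, hmin⟩, -⟩ := hO.1 p q r hp hq hr
  rw [hO.meet_join_eq hp hr hab hac hbc hpj hrj] at ha hmin
  rw [hO.meet_join_eq hp hq (meet_comm a b ▸ hab) hbc hac hpj.symm hqj] at hb hmin
  rw [hO.meet_join_eq hq hr (meet_comm b c ▸ hbc) (meet_comm a c ▸ hac)
    (meet_comm a b ▸ hab) hqj.symm hrj.symm] at hc hmin
  refine ⟨m, ha, hb, hc, fun s has hbs hcs => ?_⟩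
  exact O.le_trans _ _ _
    (hmin (O.meet m s) (hm.of_le (O.meet_le_left _ _)) (O.le_meet _ _ _ hb hbs)
      (O.le_meet _ _ _ hc hcs) (O.le_meet _ _ _ ha has))
    (O.meet_le_right _ _)

theorem IsJoin3.swap {a b c m : Y} (h : O.IsJoin3 a b c m) : O.IsJoin3 b a c m :=
  ⟨h.2.1, h.1, h.2.2.1, fun s hb ha hc => h.2.2.2 s ha hb hc⟩

theorem IsJoin3.rotate {a b c m : Y} (h : O.IsJoin3 a b c m) : O.IsJoin3 c a b m :=
  ⟨h.2.2.1, h.1, h.2.1, fun s hc ha hb => h.2.2.2 s ha hb hc⟩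

theorem pt_eq {x y z : Y} (h : O.IsJoin y x (O.op y z)) : O.pt y x = z := by
  have hex : ∃ j, O.IsJoin y x j := ⟨_, h⟩
  have hjn : O.jn y x = O.op y z := by
    rw [jn, dif_pos hex]
    exact hex.choose_spec.unique h
  have hdiv : ∃ w, O.op y z = O.op y w := ⟨z, rfl⟩
  rw [pt, hjn, rdiv, dif_pos hdiv]
  exact O.cancel_left _ _ _ hdiv.choose_spec.symm

theorem Orth.isJoin_pt {x y : Y} (h : O.Orth y x) : O.IsJoin y x (O.op y (O.pt y x)) := by
  obtain ⟨-, j, hj⟩ := h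
  obtain ⟨z, rfl⟩ := (O.le_iff _ _).1 hj.1
  rwa [pt_eq hj]

theorem Orth.symm {x y : Y} (h : O.Orth x y) : O.Orth y x :=
  ⟨meet_comm x y ▸ h.1, h.2.imp fun _ hj => hj.symm⟩

theorem Orth.op_pt {x y : Y} (h : O.Orth x y) :
    O.op x (O.pt x y) = O.op y (O.pt y x) :=
  h.isJoin_pt.unique h.symm.isJoin_pt.symm

/-- The corner at `a` of the cube spanned by `a`, `b`, `c`. -/
theorem Orth.pt_corner {a b c m : Y} (hab : O.Orth a b) (hac : O.Orth a c)
    (hmeet : O.meet (O.op a (O.pt a b)) (O.op a (O.pt a c)) = a) (hm : O.IsJoin3 a b c m) :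
    O.Orth (O.pt a b) (O.pt a c) ∧
      O.op (O.op a (O.pt a b)) (O.pt (O.pt a b) (O.pt a c)) = m ∧
      O.op (O.op a (O.pt a c)) (O.pt (O.pt a c) (O.pt a b)) = m := by
  have hj₁ := hab.isJoin_pt
  have hj₂ := hac.isJoin_pt
  obtain ⟨n, rfl⟩ := (O.le_iff _ _).1 hm.1
  have hn : O.IsJoin (O.pt a b) (O.pt a c) n := by
    apply isJoin_of_op (a := a)
    refine ⟨hj₁.2.2 _ hm.1 hm.2.1, hj₂.2.2 _ hm.1 hm.2.2.1, fun s h₁ h₂ => ?_⟩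
    exact hm.2.2.2 s (O.le_trans _ _ _ hj₁.1 h₁) (O.le_trans _ _ _ hj₁.2.1 h₁)
      (O.le_trans _ _ _ hj₂.2.1 h₂)
  have ho : O.Orth (O.pt a b) (O.pt a c) := by
    refine ⟨eq_id_of_le_id ((op_le_op_iff (x := a)).1 ?_), n, hn⟩
    rw [O.op_id]
    exact O.le_trans _ _ _ (O.le_meet _ _ _ (op_le_op_iff.2 (O.meet_le_left _ _))
      (op_le_op_iff.2 (O.meet_le_right _ _))) (hmeet.symm ▸ O.le_refl a)
  refine ⟨ho, ?_, ?_⟩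
  · rw [O.op_assoc, ho.isJoin_pt.unique hn]
  · rw [O.op_assoc, ho.symm.isJoin_pt.unique hn.symm]

end

end OreData

/-- **Spanning a cube.** If `a, b, c` are pairwise orthogonal admissible elements of an
ore, then `Φ_a(b) ⊥ Φ_a(c)`, `Φ_b(a) ⊥ Φ_b(c)`, `Φ_c(a) ⊥ Φ_c(b)`, and the stated
equalities of iterated parallel transports hold. -/
theorem stmt12 {Y : Type} (O : OreData Y) (hO : O.IsOre) (a b c : Y)
    (ha : O.Admissible a) (hb : O.Admissible b) (hc : O.Admissible c)
    (hab : O.Orth a b) (hac : O.Orth a c) (hbc : O.Orth b c) :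
    O.Orth (O.pt a b) (O.pt a c) ∧ O.Orth (O.pt b a) (O.pt b c) ∧
    O.Orth (O.pt c a) (O.pt c b) ∧
    O.pt (O.pt c b) (O.pt c a) = O.pt (O.pt b c) (O.pt b a) ∧
    O.pt (O.pt a b) (O.pt a c) = O.pt (O.pt b a) (O.pt b c) ∧
    O.pt (O.pt c a) (O.pt c b) = O.pt (O.pt a c) (O.pt a b) := by
  have hp := hO.admissible_of_isJoin ha hb hab hab.isJoin_pt
  have hq := hO.admissible_of_isJoin hb hc hbc hbc.isJoin_pt
  have hr := hO.admissible_of_isJoin ha hc hac hac.isJoin_pt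
  obtain ⟨m, hm⟩ := hO.exists_isJoin3 hp hq hr hab.1 hac.1 hbc.1 hab.isJoin_pt hbc.isJoin_pt
    hac.isJoin_pt
  obtain ⟨oa, a₁, a₂⟩ := hab.pt_corner hac
    (hO.meet_join_eq hp hr hab.1 hac.1 hbc.1 hab.isJoin_pt hac.isJoin_pt) hm
  obtain ⟨ob, b₁, b₂⟩ := hab.symm.pt_corner hbc
    (hO.meet_join_eq (hab.op_pt ▸ hp) hq hab.symm.1 hbc.1 hac.1 hab.symm.isJoin_pt
      hbc.isJoin_pt) hm.swap
  obtain ⟨oc, c₁, c₂⟩ := hac.symm.pt_corner hbc.symm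
    (hO.meet_join_eq (hac.op_pt ▸ hr) (hbc.op_pt ▸ hq) hac.symm.1 hbc.symm.1 hab.1
      hac.symm.isJoin_pt hbc.symm.isJoin_pt) hm.rotate
  refine ⟨oa, ob, oc, O.cancel_left _ _ _ ((c₂.trans b₂.symm).trans ?_),
    O.cancel_left _ _ _ ((a₁.trans b₁.symm).trans ?_),
    O.cancel_left _ _ _ ((c₁.trans a₂.symm).trans ?_)⟩
  · rw [hbc.op_pt]
  · rw [hab.op_pt]
  · rw [hac.op_pt]
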